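/- Let R_1, R_2 be reduced words for the longest element w_0 ∈ S_n. Then R_1 and R_2 are commutation-equivalent if and only if T_{R_1}(a,b,c) = T_{R_2}(a,b,c) for all triples 1 ≤ a < b < c ≤ n. -/

import Mathlib

open scoped Classical

namespace BSDist

/-- The simple transposition `s i` (1-indexed): it swaps the values `i` and `i+1`
of `{1,…,n}`, i.e. the elements `i-1` and `i` of `Fin n`.  Out-of-range letters
give the identity. -/
def sTr (n : ℕ) (i : ℕ) : Equiv.Perm (Fin n) :=
  if h : 1 ≤ i ∧ i < n then Equiv.swap ⟨i - 1, by omega⟩ ⟨i, h.2⟩ else 1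

/-- The product `w(R) = s_{i₁} ⋯ s_{i_L}` of a word. -/
def wprod (n : ℕ) (R : List ℕ) : Equiv.Perm (Fin n) := (R.map (sTr n)).prod

/-- The Coxeter length of a permutation: its number of inversions. -/
def len {n : ℕ} (w : Equiv.Perm (Fin n)) : ℕ :=
  (Finset.univ.filter (fun p : Fin n × Fin n => p.1 < p.2 ∧ w p.2 < w p.1)).card

/-- A word over the alphabet `{1,…,n-1}`. -/
def Alphabet (n : ℕ) (R : List ℕ) : Prop := ∀ i ∈ R, 1 ≤ i ∧ i < n

/-- `R` is a reduced word (over the alphabet `{1,…,n-1}`). -/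
def IsReducedWord (n : ℕ) (R : List ℕ) : Prop :=
  Alphabet n R ∧ R.length = len (wprod n R)

/-- `R` is a reduced word for `w`. -/
def IsReducedWordFor (n : ℕ) (R : List ℕ) (w : Equiv.Perm (Fin n)) : Prop :=
  IsReducedWord n R ∧ wprod n R = w

/-- The weight `wt_R : S_n → ℤ[q]`, defined by the recursion
`wt_∅(e) = 1`, `wt_∅(x) = 0` for `x ≠ e`, and for an appended letter `i`:
`wt_{Ri}(x) = wt_R(x) + wt_R(x sᵢ)` if `ℓ(x sᵢ) > ℓ(x)`, and
`wt_{Ri}(x) = q·wt_R(x) + q·wt_R(x sᵢ)` if `ℓ(x sᵢ) < ℓ(x)`. -/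
noncomputable def wt (n : ℕ) (R : List ℕ) : Equiv.Perm (Fin n) → Polynomial ℤ :=
  R.foldl
    (fun f i x =>
      if len x < len (x * sTr n i) then f x + f (x * sTr n i)
      else Polynomial.X * f x + Polynomial.X * f (x * sTr n i))
    (fun x => if x = 1 then 1 else 0)

/-- A single commutation move: replace a consecutive factor `ij` by `ji` where
`|i - j| > 1`. -/
def CommMove (R R' : List ℕ) : Prop :=
  ∃ (A B : List ℕ) (i j : ℕ), (i + 1 < j ∨ j + 1 < i) ∧
    R = A ++ [i, j] ++ B ∧ R' = A ++ [j, i] ++ B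

/-- Commutation equivalence: a finite sequence of commutation moves. -/
def CommEquiv (R R' : List ℕ) : Prop := Relation.ReflTransGen CommMove R R'

/-- A single braid move: replace a consecutive factor `k(k+1)k` by `(k+1)k(k+1)`. -/
def BraidMove (R R' : List ℕ) : Prop :=
  ∃ (A B : List ℕ) (k : ℕ),
    R = A ++ [k, k + 1, k] ++ B ∧ R' = A ++ [k + 1, k, k + 1] ++ B

/-- The Demazure product of a word, computed left to right:
`w ∗ sᵢ = w sᵢ` if `ℓ(w sᵢ) > ℓ(w)`, and `w ∗ sᵢ = w` otherwise. -/
def dem (n : ℕ) (R : List ℕ) : Equiv.Perm (Fin n) :=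
  R.foldl (fun w i => if len w < len (w * sTr n i) then w * sTr n i else w) 1

/-- `app w t` is the value `w(t)` in 1-indexed one-line notation:
positions and values both run through `{1,…,n}`. -/
def app {n : ℕ} (w : Equiv.Perm (Fin n)) (t : ℕ) : ℕ :=
  if h : 1 ≤ t ∧ t ≤ n then ((w ⟨t - 1, by omega⟩ : Fin n) : ℕ) + 1 else 0

/-- `posOf x t = x⁻¹(t)`, the (1-indexed) position of the value `t` in `x`. -/
def posOf {n : ℕ} (x : Equiv.Perm (Fin n)) (t : ℕ) : ℕ := app x⁻¹ t

/-- The longest element `w₀` of `S_n` (the order-reversing permutation). -/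
def w0 (n : ℕ) : Equiv.Perm (Fin n) := ⟨Fin.rev, Fin.rev, Fin.rev_rev, Fin.rev_rev⟩

/-- The value pair `(a,b)` (with `a < b`) is an inversion of `x`:
`x⁻¹(a) > x⁻¹(b)`. -/
def IsInversion {n : ℕ} (x : Equiv.Perm (Fin n)) (a b : ℕ) : Prop :=
  posOf x b < posOf x a

/-- `tau R a b` is the first time `k` at which the pair `(a,b)` is an inversion
of the prefix product `s_{i₁} ⋯ s_{i_k}`. -/
noncomputable def tau (n : ℕ) (R : List ℕ) (a b : ℕ) : ℕ :=
  sInf {k | IsInversion (wprod n (R.take k)) a b}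

/-- `T_R(a,b,c) = +1` if `τ_R(a,b) < τ_R(b,c)` and `-1` otherwise. -/
noncomputable def T (n : ℕ) (R : List ℕ) (a b c : ℕ) : ℤ :=
  if tau n R a b < tau n R b c then 1 else -1

/-- `Supp(x) = {t : pos_x(t) ≠ pos_{w₀}(t)}`. -/
noncomputable def Supp (n : ℕ) (x : Equiv.Perm (Fin n)) : Finset ℕ :=
  (Finset.Icc 1 n).filter (fun t => posOf x t ≠ posOf (w0 n) t)

/-- `Fwd(x) = {t : pos_x(t) < pos_{w₀}(t)}`. -/
noncomputable def Fwd (n : ℕ) (x : Equiv.Perm (Fin n)) : Finset ℕ :=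
  (Finset.Icc 1 n).filter (fun t => posOf x t < posOf (w0 n) t)

/-- `Bwd(x) = {t : pos_x(t) > pos_{w₀}(t)}`. -/
noncomputable def Bwd (n : ℕ) (x : Equiv.Perm (Fin n)) : Finset ℕ :=
  (Finset.Icc 1 n).filter (fun t => posOf (w0 n) t < posOf x t)

/-- `D_R(x)`: the coefficient of `q^{N-1}` in `wt_R(x)`, where `N = n(n-1)/2`. -/
noncomputable def D (n : ℕ) (R : List ℕ) (x : Equiv.Perm (Fin n)) : ℤ :=
  (wt n R x).coeff (n * (n - 1) / 2 - 1)

/-- `σ_b(x) = sign(pos_x(b) − pos_{w₀}(b)) ∈ {−1,0,+1}`. -/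
noncomputable def sigmaVal (n : ℕ) (b : ℕ) (x : Equiv.Perm (Fin n)) : ℤ :=
  Int.sign ((posOf x b : ℤ) - (posOf (w0 n) b : ℤ))

/-- `Θ_R(a,b,c) = Σ_{x : Supp(x) = [a,c]} D_R(x)·σ_b(x)`. -/
noncomputable def Theta (n : ℕ) (R : List ℕ) (a b c : ℕ) : ℤ :=
  ∑ x ∈ Finset.univ.filter (fun x : Equiv.Perm (Fin n) => Supp n x = Finset.Icc a c),
    D n R x * sigmaVal n b x

end BSDist

namespace BSDist


/-- position (0-indexed) of the value `a` after `k` letters. -/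
def pos (n : ℕ) (R : List ℕ) (k : ℕ) (a : Fin n) : ℕ := (((wprod n (R.take k))⁻¹ a : Fin n) : ℕ)

/-- action of a letter on positions. -/
def sw (i x : ℕ) : ℕ := if x + 1 = i then i else if x = i then i - 1 else x

theorem sTr_val (n i : ℕ) (h : 1 ≤ i ∧ i < n) (y : Fin n) : ((sTr n i y : Fin n) : ℕ) = sw i y := by
  unfold sTr sw
  rw [dif_pos h, Equiv.swap_apply_def]
  simp only [Fin.ext_iff]
  split_ifs <;> (try dsimp only) <;> omega

theorem sTr_inv (n i : ℕ) : (sTr n i)⁻¹ = sTr n i := by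
  unfold sTr; split_ifs <;> simp

theorem wprod_append (n : ℕ) (A B : List ℕ) : wprod n (A ++ B) = wprod n A * wprod n B := by
  simp [wprod]

theorem pos_zero (n : ℕ) (R : List ℕ) (a : Fin n) : pos n R 0 a = a := by
  simp [pos, wprod]

theorem pos_inj {n : ℕ} {R : List ℕ} {k : ℕ} {a b : Fin n} (h : pos n R k a = pos n R k b) :
    a = b := by
  unfold pos at h
  exact (wprod n (R.take k))⁻¹.injective (Fin.ext h)

theorem pos_ex {n : ℕ} (R : List ℕ) (k : ℕ) {x : ℕ} (h : x < n) : ∃ a : Fin n, pos n R k a = x := by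
  refine ⟨wprod n (R.take k) ⟨x, h⟩, ?_⟩
  simp [pos]

theorem pos_succ {n : ℕ} {R : List ℕ} (hR : Alphabet n R) {k : ℕ} (hk : k < R.length) (a : Fin n) :
    pos n R (k+1) a = sw R[k] (pos n R k a) := by
  unfold pos
  rw [List.take_succ_eq_append_getElem hk, wprod_append]
  have : wprod n [R[k]] = sTr n R[k] := by simp [wprod]
  rw [this, mul_inv_rev, sTr_inv, Equiv.Perm.mul_apply, sTr_val _ _ (hR _ (List.getElem_mem hk))]

theorem pos_final {n : ℕ} {R : List ℕ} (h : IsReducedWordFor n R (w0 n)) {k : ℕ}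
    (hk : R.length ≤ k) (a : Fin n) : pos n R k a + a + 1 = n := by
  unfold pos
  rw [List.take_of_length_le hk, h.2]
  have : (w0 n)⁻¹ a = Fin.rev a := rfl
  rw [this, Fin.val_rev]; omega

/-- pair `{a,b}` is crossed at time `k`. -/
def Cr (n : ℕ) (R : List ℕ) (k : ℕ) (a b : Fin n) : Prop :=
  (a < b ∧ pos n R k b < pos n R k a) ∨ (b < a ∧ pos n R k a < pos n R k b)

theorem Cr_symm {n : ℕ} {R : List ℕ} {k : ℕ} {a b : Fin n} : Cr n R k a b ↔ Cr n R k b a := by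
  unfold Cr; exact or_comm

noncomputable def tm (n : ℕ) (R : List ℕ) (a b : Fin n) : ℕ := sInf {k | Cr n R k a b}

theorem tm_symm {n : ℕ} {R : List ℕ} (a b : Fin n) : tm n R a b = tm n R b a := by
  unfold tm; congr 1; ext k; exact Cr_symm

theorem Cr_lt {n : ℕ} {R : List ℕ} {k : ℕ} {a b : Fin n} (h : a < b) :
    Cr n R k a b ↔ pos n R k b < pos n R k a := by
  unfold Cr
  have := h.not_gt
  tauto

theorem Cr_final {n : ℕ} {R : List ℕ} (h : IsReducedWordFor n R (w0 n)) {k : ℕ}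
    (hk : R.length ≤ k) {a b : Fin n} (hab : a ≠ b) : Cr n R k a b := by
  have h1 := pos_final h hk a
  have h2 := pos_final h hk b
  unfold Cr
  simp only [Fin.lt_def]
  have : (a:ℕ) ≠ b := fun h => hab (Fin.ext h)
  omega

theorem Cr_zero {n : ℕ} {R : List ℕ} {a b : Fin n} : ¬ Cr n R 0 a b := by
  unfold Cr
  simp only [Fin.lt_def, pos_zero]
  omega

theorem tm_spec {n : ℕ} {R : List ℕ} (h : IsReducedWordFor n R (w0 n)) {a b : Fin n} (hab : a ≠ b) :
    Cr n R (tm n R a b) a b :=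
  Nat.sInf_mem (s := {k | Cr n R k a b}) ⟨R.length, Cr_final h le_rfl hab⟩

theorem tm_le {n : ℕ} {R : List ℕ} {a b : Fin n} {k : ℕ} (h : Cr n R k a b) : tm n R a b ≤ k :=
  Nat.sInf_le h

theorem tm_pos {n : ℕ} {R : List ℕ} (h : IsReducedWordFor n R (w0 n)) {a b : Fin n} (hab : a ≠ b) :
    1 ≤ tm n R a b := by
  by_contra hc
  have h0 : tm n R a b = 0 := by omega
  have := tm_spec h hab
  rw [h0] at this
  exact Cr_zero this

theorem sw_flip {i x y : ℕ} (hi : 1 ≤ i) (hxy : x < y) (h : sw i y < sw i x) : x + 1 = i ∧ y = i := by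
  unfold sw at h
  split_ifs at h <;> omega

theorem up_step {n : ℕ} {R : List ℕ} (hR : Alphabet n R) {k : ℕ} (hk : k < R.length) {a b : Fin n}
    (hab : a < b) (h1 : ¬ Cr n R k a b) (h2 : Cr n R (k+1) a b) :
    pos n R k a + 1 = R[k] ∧ pos n R k b = R[k] := by
  rw [Cr_lt hab] at h1 h2
  rw [pos_succ hR hk, pos_succ hR hk] at h2
  refine sw_flip (hR _ (List.getElem_mem hk)).1 ?_ h2
  rcases lt_trichotomy (pos n R k a) (pos n R k b) with h | h | h
  · exact h
  · exact absurd (pos_inj h) hab.ne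
  · exact absurd h h1

theorem down_step {n : ℕ} {R : List ℕ} (hR : Alphabet n R) {k : ℕ} (hk : k < R.length) {a b : Fin n}
    (hab : a < b) (h1 : Cr n R k a b) (h2 : ¬ Cr n R (k+1) a b) :
    pos n R k b + 1 = R[k] ∧ pos n R k a = R[k] := by
  have hne : pos n R (k+1) a ≠ pos n R (k+1) b := fun h => hab.ne (pos_inj h)
  rw [Cr_lt hab] at h1 h2
  rw [pos_succ hR hk, pos_succ hR hk] at h2 hne
  exact sw_flip (hR _ (List.getElem_mem hk)).1 h1 (by omega)

theorem tm_up {n : ℕ} {R : List ℕ} (h : IsReducedWordFor n R (w0 n)) {a b : Fin n} (hab : a < b) {k : ℕ}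
    (hk : tm n R a b = k + 1) : ∃ hk : k < R.length,
    pos n R k a + 1 = R[k] ∧ pos n R k b = R[k] := by
  have h1 : ¬ Cr n R k a b := fun hc => by have := tm_le hc; omega
  have h2 := tm_spec h hab.ne
  rw [hk] at h2
  have hl : k < R.length := by
    by_contra hc
    exact h1 (Cr_final h (by omega) hab.ne)
  exact ⟨hl, up_step h.1.1 hl hab h1 h2⟩

theorem Cr_succ {n : ℕ} {R : List ℕ} (h : IsReducedWordFor n R (w0 n)) {a b : Fin n} {k : ℕ}
    (hab : a < b) (hc : Cr n R k a b) : Cr n R (k+1) a b := by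
  by_cases hk : k < R.length
  swap
  · exact Cr_final h (by omega) hab.ne
  by_contra hn
  obtain ⟨d1, d2⟩ := down_step h.1.1 hk hab hc hn
  let S := (Finset.univ.filter (fun p : Fin n × Fin n => p.1 < p.2))
  have hS : S.card = R.length := by
    rw [h.1.2, h.2]
    unfold len
    congr 1
    ext p
    have hw : ∀ x, w0 n x = Fin.rev x := fun x => rfl
    simp [S, hw]
  have hsurj := Finset.surjOn_of_injOn_of_card_le (s := S) (t := Finset.range R.length)
    (fun p => tm n R p.1 p.2 - 1) (by
      intro p hp
      have hp : p.1 < p.2 := by simpa [S] using hp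
      have h1 := tm_pos h hp.ne
      have h2 := tm_le (Cr_final h le_rfl hp.ne)
      simp only [Finset.coe_range, Set.mem_Iio]
      omega) (by
      intro p hp q hq hpq
      have hp : p.1 < p.2 := by simpa [S] using hp
      have hq : q.1 < q.2 := by simpa [S] using hq
      have h1 := tm_pos h hp.ne
      have h2 := tm_pos h hq.ne
      dsimp only at hpq
      obtain ⟨l1, u1, u2⟩ := tm_up h hp (k := tm n R p.1 p.2 - 1) (by omega)
      obtain ⟨l2, v1, v2⟩ := tm_up h hq (k := tm n R p.1 p.2 - 1) (by omega)
      refine Prod.ext (pos_inj (R := R) (k := tm n R p.1 p.2 - 1) ?_) 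
        (pos_inj (R := R) (k := tm n R p.1 p.2 - 1) ?_) <;> omega) (by simp [hS])
  obtain ⟨p, hp, hpk⟩ := hsurj (show k ∈ ((Finset.range R.length : Finset ℕ) : Set ℕ) by simpa using hk)
  have hp : p.1 < p.2 := by simpa [S] using hp
  have h1 := tm_pos h hp.ne
  dsimp only at hpk
  obtain ⟨l1, u1, u2⟩ := tm_up h hp (k := k) (by omega)
  have e1 : p.1 = b := pos_inj (R := R) (k := k) (by omega)
  have e2 : p.2 = a := pos_inj (R := R) (k := k) (by omega)
  rw [e1, e2] at hp
  exact absurd hp hab.not_gt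

theorem Cr_iff {n : ℕ} {R : List ℕ} (h : IsReducedWordFor n R (w0 n)) {a b : Fin n} {k : ℕ}
    (hab : a ≠ b) : Cr n R k a b ↔ tm n R a b ≤ k := by
  refine ⟨tm_le, fun hk => ?_⟩
  induction k, hk using Nat.le_induction with
  | base => exact tm_spec h hab
  | succ m _ ih =>
    rcases lt_or_gt_of_ne hab with hl | hl
    · exact Cr_succ h hl ih
    · exact Cr_symm.1 (Cr_succ h hl (Cr_symm.1 ih))

/-- a letter acting at positions of `a,b` crosses them. -/
theorem tm_of_pos {n : ℕ} {R : List ℕ} (h : IsReducedWordFor n R (w0 n)) {a b : Fin n} {k : ℕ}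
    (hk : k < R.length) (ha : pos n R k a + 1 = R[k]) (hb : pos n R k b = R[k]) :
    a < b ∧ tm n R a b = k + 1 := by
  have sa : pos n R (k+1) a = R[k] := by rw [pos_succ h.1.1 hk]; unfold sw; simp [ha]
  have sb : pos n R (k+1) b + 1 = R[k] := by
    rw [pos_succ h.1.1 hk, hb]
    have := (h.1.1 _ (List.getElem_mem hk)).1
    unfold sw; simp; omega
  rcases lt_trichotomy a b with hab | hab | hab
  · refine ⟨hab, ?_⟩
    have h1 : ¬ Cr n R k a b := by rw [Cr_lt hab]; omega
    have h2 : Cr n R (k+1) a b := by rw [Cr_lt hab]; omega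
    rw [Cr_iff h hab.ne] at h1 h2
    omega
  · subst hab; omega
  · have h1 : Cr n R k b a := by rw [Cr_lt hab]; omega
    have h2 : ¬ Cr n R (k+1) b a := by rw [Cr_lt hab]; omega
    exact absurd (Cr_succ h hab h1) h2

theorem tau_eq {n : ℕ} {R : List ℕ} {a b : Fin n} (hab : a < b) :
    tau n R (a + 1) (b + 1) = tm n R a b := by
  unfold tau tm
  congr 1; ext k
  simp only [Set.mem_ofPred_eq, Cr_lt hab, IsInversion, posOf, app, pos]
  have := a.2
  have := b.2
  rw [dif_pos (by omega), dif_pos (by omega)]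
  simp

theorem triple {n : ℕ} {R : List ℕ} (h : IsReducedWordFor n R (w0 n)) {a b c : Fin n} (hab : a < b)
    (hbc : b < c) : (tm n R a b < tm n R a c ∧ tm n R a c < tm n R b c) ∨
      (tm n R b c < tm n R a c ∧ tm n R a c < tm n R a b) := by
  have hac := hab.trans hbc
  have key : ∀ k, (Cr n R k a b → Cr n R k b c → Cr n R k a c) ∧
      (Cr n R k a c → Cr n R k a b ∨ Cr n R k b c) := by
    intro k
    rw [Cr_lt hab, Cr_lt hbc, Cr_lt hac]
    omega
  have ne : ∀ {p q r s : Fin n}, p < q → r < s → (p ≠ r ∨ q ≠ s) → tm n R p q ≠ tm n R r s := by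
    intro p q r s h1 h2 h3 he
    have h4 := tm_pos h h1.ne
    obtain ⟨l1, u1, u2⟩ := tm_up h h1 (k := tm n R p q - 1) (by omega)
    obtain ⟨l2, v1, v2⟩ := tm_up h h2 (k := tm n R p q - 1) (by omega)
    rcases h3 with h3 | h3
    · exact h3 (pos_inj (R := R) (k := tm n R p q - 1) (by omega))
    · exact h3 (pos_inj (R := R) (k := tm n R p q - 1) (by omega))
  have n1 := ne hab hac (Or.inr hbc.ne)
  have n2 := ne hab hbc (Or.inl hab.ne)
  have n3 := ne hac hbc (Or.inl hab.ne)
  have k1 := (key (tm n R a c)).2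
  have k2 := (key (max (tm n R a b) (tm n R b c))).1
  rw [Cr_iff h hab.ne, Cr_iff h hbc.ne, Cr_iff h hac.ne] at k1 k2
  omega

/-- T-equality in terms of `tm`. -/
def SameT (n : ℕ) (R R' : List ℕ) : Prop := ∀ a b c : Fin n, a < b → b < c →
  (tm n R a b < tm n R b c ↔ tm n R' a b < tm n R' b c)

theorem T_iff (n : ℕ) (R R' : List ℕ) : (∀ a b c : ℕ, 1 ≤ a → a < b → b < c → c ≤ n →
        T n R a b c = T n R' a b c) ↔ SameT n R R' := by
  have aux : ∀ (p q : Prop) [Decidable p] [Decidable q], ((if p then (1:ℤ) else -1) = (if q then 1 else -1)) ↔ (p ↔ q) := by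
    intro p q _ _
    by_cases p <;> by_cases q <;> simp [*]
  constructor
  · intro h a b c hab hbc
    have := h (a+1) (b+1) (c+1) (by omega) (by have := Fin.lt_def.1 hab; omega) 
      (by have := Fin.lt_def.1 hbc; omega) (by have := c.2; omega)
    unfold T at this
    rwa [aux, tau_eq hab, tau_eq hbc, tau_eq hab, tau_eq hbc] at this
  · intro h a b c ha hab hbc hc
    obtain ⟨a, rfl⟩ : ∃ a', a = a' + 1 := ⟨a - 1, by omega⟩
    obtain ⟨b, rfl⟩ : ∃ a', b = a' + 1 := ⟨b - 1, by omega⟩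
    obtain ⟨c, rfl⟩ : ∃ a', c = a' + 1 := ⟨c - 1, by omega⟩
    have hab' : (⟨a, by omega⟩ : Fin n) < ⟨b, by omega⟩ := by simp; omega
    have hbc' : (⟨b, by omega⟩ : Fin n) < ⟨c, by omega⟩ := by simp; omega
    have := h _ _ _ hab' hbc'
    unfold T
    rw [aux]
    rwa [← tau_eq hab', ← tau_eq hbc', ← tau_eq hab', ← tau_eq hbc'] at this

theorem SameT.symm {n : ℕ} {R R' : List ℕ} (h : SameT n R R') : SameT n R' R :=
  fun a b c h1 h2 => (h a b c h1 h2).symm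

theorem SameT.trans {n : ℕ} {R R' R'' : List ℕ} (h : SameT n R R') (h' : SameT n R' R'') : SameT n R R'' :=
  fun a b c h1 h2 => (h a b c h1 h2).trans (h' a b c h1 h2)

theorem order {n : ℕ} {R R' : List ℕ} (h : IsReducedWordFor n R (w0 n))
    (h' : IsReducedWordFor n R' (w0 n)) (hT : SameT n R R') {p q r : Fin n} (hpq : p ≠ q) (hpr : p ≠ r)
    (hqr : q ≠ r) (hl : tm n R p q < tm n R p r) : tm n R' p q < tm n R' p r := by
  have key : ∀ a b c : Fin n, a < b → b < c → 
    ((tm n R a b < tm n R a c ↔ tm n R' a b < tm n R' a c) ∧ 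
     (tm n R a c < tm n R a b ↔ tm n R' a c < tm n R' a b) ∧ 
     (tm n R a b < tm n R b c ↔ tm n R' a b < tm n R' b c) ∧ 
     (tm n R b c < tm n R a b ↔ tm n R' b c < tm n R' a b) ∧ 
     (tm n R b c < tm n R a c ↔ tm n R' b c < tm n R' a c) ∧ 
     (tm n R a c < tm n R b c ↔ tm n R' a c < tm n R' b c)) := by
    intro a b c h1 h2
    have := hT a b c h1 h2
    have := triple h h1 h2
    have := triple h' h1 h2
    omega
  have e1 := tm_symm (R := R) p q
  have e2 := tm_symm (R := R) p r
  have e3 := tm_symm (R := R) q r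
  have f1 := tm_symm (R := R') p q
  have f2 := tm_symm (R := R') p r
  have f3 := tm_symm (R := R') q r
  rcases lt_or_gt_of_ne hpq with h1 | h1 <;> rcases lt_or_gt_of_ne hpr with h2 | h2 <;>
    rcases lt_or_gt_of_ne hqr with h3 | h3
  · have := key _ _ _ h1 h3; omega
  · have := key _ _ _ h2 h3; omega
  · exact absurd (h1.trans h3) h2.not_gt
  · have := key _ _ _ h2 h1; omega
  · have := key _ _ _ h1 h2; omega
  · exact absurd (h2.trans h3) h1.not_gt
  · have := key _ _ _ h3 h2; omega
  · have := key _ _ _ h3 h1; omega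

theorem sw_comm {i j x : ℕ} (hij : i + 1 < j ∨ j + 1 < i) : sw i (sw j x) = sw j (sw i x) := by
  unfold sw; split_ifs <;> omega

theorem sTr_comm {n i j : ℕ} (hi : 1 ≤ i ∧ i < n) (hj : 1 ≤ j ∧ j < n) (hij : i + 1 < j ∨ j + 1 < i) :
    sTr n i * sTr n j = sTr n j * sTr n i := by
  ext x
  simp only [Equiv.Perm.mul_apply, sTr_val _ _ hi, sTr_val _ _ hj, sw_comm hij]

theorem CommMove.symm {R R' : List ℕ} (h : CommMove R R') : CommMove R' R := by
  obtain ⟨A, B, i, j, h1, h2, h3⟩ := h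
  exact ⟨A, B, j, i, h1.symm, h3, h2⟩

theorem move_wprod {n i j : ℕ} (hi : 1 ≤ i ∧ i < n) (hj : 1 ≤ j ∧ j < n) (hij : i + 1 < j ∨ j + 1 < i) 
    (A B : List ℕ) : wprod n (A ++ [i, j] ++ B) = wprod n (A ++ [j, i] ++ B) := by
  simp only [wprod_append]
  congr 2
  simp [wprod, sTr_comm hi hj hij]

theorem move_red {n : ℕ} {R R' : List ℕ} (h : IsReducedWordFor n R (w0 n)) (hm : CommMove R R') :
    IsReducedWordFor n R' (w0 n) := by
  obtain ⟨A, B, i, j, h1, rfl, rfl⟩ := hm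
  have hi := h.1.1 i (by simp)
  have hj := h.1.1 j (by simp)
  have hw := move_wprod hi hj h1 A B
  refine ⟨⟨?_, ?_⟩, ?_⟩
  · intro x hx
    apply h.1.1 x
    simp at hx ⊢
    tauto
  · rw [← hw, ← h.1.2]; simp
  · rw [← hw]; exact h.2

theorem move_half {n : ℕ} {R R' : List ℕ} (h : IsReducedWordFor n R (w0 n)) (hm : CommMove R R')
    {a b c : Fin n} (hab : a < b) (hbc : b < c) (ht : tm n R a b < tm n R b c) :
    tm n R' a b < tm n R' b c := by
  have h' := move_red h hm
  obtain ⟨A, B, i, j, h1, rfl, rfl⟩ := hm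
  have hi := h.1.1 i (by simp)
  have hj := h.1.1 j (by simp)
  have hcr : ∀ k, k ≠ A.length + 1 → ∀ x y : Fin n, x ≠ y → 
      (tm n (A ++ [i, j] ++ B) x y ≤ k ↔ tm n (A ++ [j, i] ++ B) x y ≤ k) := by
    intro k hk x y hxy
    rw [← Cr_iff h hxy, ← Cr_iff h' hxy]
    have : wprod n ((A ++ [i, j] ++ B).take k) = wprod n ((A ++ [j, i] ++ B).take k) := by
      rcases Nat.lt_or_ge k (A.length + 1) with hl | hl
      · simp only [List.append_assoc]
        rw [List.take_append_of_le_length (by omega), List.take_append_of_le_length (by omega)]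
      · obtain ⟨m, rfl⟩ : ∃ m, k = A.length + (m + 2) := ⟨k - A.length - 2, by omega⟩
        simp only [List.append_assoc]
        rw [List.take_length_add_append, List.take_length_add_append]
        have := move_wprod hi hj h1 A (B.take m)
        simpa using this
    unfold Cr pos
    rw [this]
  have hnot : ¬ (tm n (A ++ [i, j] ++ B) a b = A.length + 1 ∧ tm n (A ++ [i, j] ++ B) b c = A.length + 1 + 1) := by
    rintro ⟨t1, t2⟩
    obtain ⟨l1, u1, u2⟩ := tm_up h hab t1
    obtain ⟨l2, v1, v2⟩ := tm_up h hbc t2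
    rw [pos_succ h.1.1 l1, u2] at v1
    have e1 : (A ++ [i, j] ++ B)[A.length] = i := by simp
    have e2 : (A ++ [i, j] ++ B)[A.length + 1] = j := by simp
    rw [e1, e2] at v1
    unfold sw at v1
    simp at v1
    omega
  by_cases hk : tm n (A ++ [i, j] ++ B) a b = A.length + 1
  · have q1 := hcr (A.length + 2) (by omega) a b hab.ne
    have q2 := hcr (A.length + 2) (by omega) b c hbc.ne
    omega
  · have q1 := hcr _ hk a b hab.ne
    have q2 := hcr _ hk b c hbc.ne
    omega

theorem move_T {n : ℕ} {R R' : List ℕ} (h : IsReducedWordFor n R (w0 n)) (hm : CommMove R R') :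
    SameT n R R' := fun _ _ _ h1 h2 =>
  ⟨move_half h hm h1 h2, move_half (move_red h hm) hm.symm h1 h2⟩

theorem equiv_T {n : ℕ} {R R' : List ℕ} (h : IsReducedWordFor n R (w0 n)) (hm : CommEquiv R R') :
    IsReducedWordFor n R' (w0 n) ∧ SameT n R R' := by
  induction hm with
  | refl => exact ⟨h, fun _ _ _ _ _ => Iff.rfl⟩
  | tail _ h2 ih => exact ⟨move_red ih.1 h2, ih.2.trans (move_T ih.1 h2)⟩

theorem CommEquiv.symm {R R' : List ℕ} (h : CommEquiv R R') : CommEquiv R' R := by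
  induction h with
  | refl => exact .refl
  | tail _ h2 ih => exact .head h2.symm ih

theorem bring {i : ℕ} (A B C : List ℕ) (hB : ∀ j ∈ B, i + 1 < j ∨ j + 1 < i) :
    CommEquiv (A ++ (B ++ i :: C)) (A ++ i :: (B ++ C)) := by
  induction B generalizing A with
  | nil => exact .refl
  | cons j B ih =>
    have h1 := ih (A ++ [j]) (fun x hx => hB x (by simp [hx]))
    simp only [List.append_assoc, List.singleton_append, List.cons_append] at h1 ⊢
    refine h1.tail ⟨A, B ++ C, j, i, (hB j (by simp)).symm, by simp, by simp⟩

theorem find {n : ℕ} {A S S' : List ℕ} {i : ℕ} (h : IsReducedWordFor n (A ++ i :: S) (w0 n)) 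
    (h' : IsReducedWordFor n (A ++ S') (w0 n)) (hT : SameT n (A ++ i :: S) (A ++ S')) :
    ∃ B C, S' = B ++ i :: C ∧ ∀ j ∈ B, i + 1 < j ∨ j + 1 < i := by
  have hi := h.1.1 i (by simp)
  set R := A ++ i :: S with hR
  set R' := A ++ S' with hR'
  have hA : A.length < R.length := by simp [hR]
  have hRi : R[A.length] = i := by simp [hR]
  have hpos : ∀ a, pos n R A.length a = pos n R' A.length a := by
    intro a; simp [pos, hR, hR']
  have hcr : ∀ a b : Fin n, a ≠ b → (tm n R a b ≤ A.length ↔ tm n R' a b ≤ A.length) := by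
    intro a b hab
    rw [← Cr_iff h hab, ← Cr_iff h' hab]
    unfold Cr
    simp only [hpos]
  obtain ⟨p, hp⟩ := pos_ex (n := n) R A.length (x := i - 1) (by omega)
  obtain ⟨q, hq⟩ := pos_ex (n := n) R A.length (x := i) (by omega)
  obtain ⟨hpq, htm⟩ := tm_of_pos h hA (a := p) (b := q) (by omega) (by omega)
  have h2 := hcr p q hpq.ne
  obtain ⟨k, hk⟩ : ∃ k, tm n R' p q = A.length + k + 1 := ⟨tm n R' p q - A.length - 1, by omega⟩
  have late : ∀ r, r ≠ p → r ≠ q → ∀ m, A.length ≤ m → m < A.length + k → 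
      tm n R' p r ≠ m + 1 ∧ tm n R' q r ≠ m + 1 := by
    intro r hrp hrq m hm1 hm2
    constructor
    · intro hc
      have a1 := order h' h hT.symm (p := p) (q := r) (r := q) hrp.symm hpq.ne hrq (by omega)
      have a2 := hcr p r hrp.symm
      omega
    · intro hc
      have s1 := tm_symm (R := R') p q
      have s2 := tm_symm (R := R) p q
      have a1 := order h' h hT.symm (p := q) (q := r) (r := p) hrq.symm hpq.ne' hrp (by omega)
      have a2 := hcr q r hrq.symm
      omega
  obtain ⟨hkl, hk1, hk2⟩ := tm_up h' hpq hk
  have stepfar : ∀ m, A.length ≤ m → (hm : m < A.length + k) → 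
      pos n R' m p + 1 = i → pos n R' m q = i → 
      (i + 1 < R'[m] ∨ R'[m] + 1 < i) := by
    intro m hm1 hm2 e1 e2
    have hj := h'.1.1 _ (List.getElem_mem (show m < R'.length by omega))
    by_contra hc
    have : R'[m] = i ∨ R'[m] = i + 1 ∨ R'[m] + 1 = i := by omega
    rcases this with e | e | e
    · have := (tm_of_pos h' (show m < R'.length by omega) (a := p) (b := q) (by omega) (by omega)).2
      omega
    · obtain ⟨r, hr⟩ := pos_ex (n := n) R' m (x := i + 1) (by omega)
      have := (tm_of_pos h' (show m < R'.length by omega) (a := q) (b := r) (by omega) (by omega)).2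
      exact (late r (by rintro rfl; omega) (by rintro rfl; omega) m hm1 hm2).2 this
    · obtain ⟨r, hr⟩ := pos_ex (n := n) R' m (x := i - 2) (by omega)
      have := (tm_of_pos h' (show m < R'.length by omega) (a := r) (b := p) (by omega) (by omega)).2
      rw [tm_symm] at this
      exact (late r (by rintro rfl; omega) (by rintro rfl; omega) m hm1 hm2).1 this
  have stay : ∀ m, m ≤ k → pos n R' (A.length + m) p + 1 = i ∧ pos n R' (A.length + m) q = i := by
    intro m
    induction m with
    | zero => intro _; have := hpos p; have := hpos q; simp only [Nat.add_zero]; omega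
    | succ m ih =>
      intro hm
      obtain ⟨e1, e2⟩ := ih (by omega)
      have := stepfar (A.length + m) (by omega) (by omega) e1 e2
      rw [← Nat.add_assoc, pos_succ h'.1.1 (by omega), pos_succ h'.1.1 (by omega)]
      unfold sw
      split_ifs <;> omega
  have hlen : R'.length = A.length + S'.length := by simp [hR']
  have hget : ∀ m (hm : m < S'.length), R'[A.length + m]'(by omega) = S'[m] := by
    intro m hm
    simp [hR']
  have hkS : k < S'.length := by omega
  refine ⟨S'.take k, S'.drop (k+1), ?_, ?_⟩
  · have h3 : S'[k] = i := by
      rw [← hget k hkS]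
      have := stay k le_rfl
      omega
    rw [← h3, List.getElem_cons_drop, List.take_append_drop]
  · intro j hj
    obtain ⟨m, hm, rfl⟩ := List.mem_iff_getElem.1 hj
    simp only [List.length_take] at hm
    rw [List.getElem_take, ← hget m (by omega)]
    obtain ⟨e1, e2⟩ := stay m (by omega)
    exact stepfar _ (by omega) (by omega) e1 e2

theorem backward {n : ℕ} (S : List ℕ) : ∀ (A S' : List ℕ), IsReducedWordFor n (A ++ S) (w0 n) →
    IsReducedWordFor n (A ++ S') (w0 n) → SameT n (A ++ S) (A ++ S') →
    CommEquiv (A ++ S) (A ++ S') := by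
  induction S with
  | nil =>
    intro A S' h h' _
    have h1 := h.1.2
    have h2 := h'.1.2
    rw [h.2] at h1
    rw [h'.2, ← h1] at h2
    have : S' = [] := by
      apply List.eq_nil_of_length_eq_zero
      simpa using h2
    subst this
    exact .refl
  | cons i S ih =>
    intro A S' h h' hT
    obtain ⟨B, C, rfl, hB⟩ := find h h' hT
    have hb := bring A B C hB
    obtain ⟨g1, g2⟩ := equiv_T h' hb
    have e : ∀ L : List ℕ, A ++ i :: L = (A ++ [i]) ++ L := by intro L; simp
    have hT' := hT.trans g2
    rw [e (B ++ C)] at g1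
    rw [e S, e (B ++ C)] at hT'
    have h0 := h
    rw [e S] at h0
    have := ih (A ++ [i]) (B ++ C) h0 g1 hT'
    rw [← e S, ← e (B ++ C)] at this
    exact Relation.ReflTransGen.trans this hb.symm

/-- Two reduced words `R₁, R₂` for the longest element
`w₀ ∈ S_n` are commutation-equivalent iff `T_{R₁}(a,b,c) = T_{R₂}(a,b,c)` for
all triples `1 ≤ a < b < c ≤ n`. -/
theorem commEquiv_iff_T_eq
    (n : ℕ) (hn : 2 ≤ n) (R₁ R₂ : List ℕ)
    (h₁ : IsReducedWordFor n R₁ (w0 n)) (h₂ : IsReducedWordFor n R₂ (w0 n)) :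
    CommEquiv R₁ R₂ ↔
      ∀ a b c : ℕ, 1 ≤ a → a < b → b < c → c ≤ n →
        T n R₁ a b c = T n R₂ a b c := by
  rw [T_iff]
  exact ⟨fun h => (equiv_T h₁ h).2, fun h => backward R₁ [] R₂ h₁ h₂ h⟩

end BSDist
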